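/- arXiv:2312.11113 — 2 statements merged into one kernel-verified Lean document; each statement's English description precedes it below -/
import Mathlib

section
/- Let (T, ⪯, f) be an order-theoretic merge tree in which any two points have a least upper bound, equipped with a consistent layer-order (≤_h). Then the induced leaf-order ⊑_L separates subtrees: for all leaves u, u1, u2 of T, if u1 ⊑_L u and u ⊑_L u2, then u ⪯ lca(u1, u2). -/
/-- An order-theoretic merge tree: a partially ordered set with a real-valued
height function that is strictly monotone, whose ancestors form chains, and in
which every point can be lifted to any height above it. `up x h` is the
(necessarily unique) ancestor of `x` at height `h` (for `f x ≤ h`). -/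
structure MergeTree (T : Type*) [PartialOrder T] where
  f : T → ℝ
  up : T → ℝ → T
  strict_mono : ∀ {x y : T}, x < y → f x < f y
  chain : ∀ {x y z : T}, x ≤ y → x ≤ z → y ≤ z ∨ z ≤ y
  le_up : ∀ (x : T) (h : ℝ), f x ≤ h → x ≤ up x h
  f_up : ∀ (x : T) (h : ℝ), f x ≤ h → f (up x h) = h

/-- A consistent layer-order on a merge tree: for every height `h`, a total
order on the level set `T_h = {x | f x = h}`, consistent with lifting. -/
structure LayerOrder {T : Type*} [PartialOrder T] (M : MergeTree T) where
  le : ℝ → T → T → Prop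
  refl : ∀ (h : ℝ) (x : T), M.f x = h → le h x x
  antisymm : ∀ (h : ℝ) (x y : T), M.f x = h → M.f y = h → le h x y → le h y x → x = y
  trans : ∀ (h : ℝ) (x y z : T), M.f x = h → M.f y = h → M.f z = h →
    le h x y → le h y z → le h x z
  total : ∀ (h : ℝ) (x y : T), M.f x = h → M.f y = h → le h x y ∨ le h y x
  consistent : ∀ (h₁ h₂ : ℝ), h₁ ≤ h₂ → ∀ (x y : T), M.f x = h₁ → M.f y = h₁ →
    le h₁ x y → le h₂ (M.up x h₂) (M.up y h₂)

/-- A leaf of a merge tree is a minimal element. -/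
def IsLeaf {T : Type*} [PartialOrder T] (x : T) : Prop := ∀ y : T, y ≤ x → y = x

/-- The leaf-order on leaves induced by a layer-order:
`u1 ⊑_L u2` iff `u1^h ≤_h u2^h` where `h = max (f u1) (f u2)`. -/
def inducedLeafLe {T : Type*} [PartialOrder T] (M : MergeTree T)
    (lay : ℝ → T → T → Prop) (u1 u2 : T) : Prop :=
  lay (max (M.f u1) (M.f u2))
    (M.up u1 (max (M.f u1) (M.f u2))) (M.up u2 (max (M.f u1) (M.f u2)))

namespace MergeTree

variable {T : Type*} [PartialOrder T] (M : MergeTree T)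

theorem f_le_f {x y : T} (h : x ≤ y) : M.f x ≤ M.f y := by
  rcases h.eq_or_lt with rfl | h
  · exact le_rfl
  · exact (M.strict_mono h).le

theorem eq_of_le_of_f_eq {x y : T} (h : x ≤ y) (hf : M.f x = M.f y) : x = y := by
  by_contra hne
  exact (M.strict_mono (lt_of_le_of_ne h hne)).ne hf

theorem ancestor_unique {x y z : T} (hy : x ≤ y) (hz : x ≤ z) (hf : M.f y = M.f z) : y = z := by
  rcases M.chain hy hz with h | h
  · exact M.eq_of_le_of_f_eq h hf
  · exact (M.eq_of_le_of_f_eq h hf.symm).symm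

theorem up_self (x : T) : M.up x (M.f x) = x :=
  M.ancestor_unique (M.le_up x _ le_rfl) le_rfl (M.f_up x _ le_rfl)

theorem up_eq_up_of_le {x y : T} (hxy : x ≤ y) {h : ℝ} (hy : M.f y ≤ h) :
    M.up x h = M.up y h := by
  have hx : M.f x ≤ h := (M.f_le_f hxy).trans hy
  exact M.ancestor_unique (M.le_up x h hx) (hxy.trans (M.le_up y h hy))
    ((M.f_up x h hx).trans (M.f_up y h hy).symm)

theorem up_up (x : T) {h₁ h₂ : ℝ} (hx : M.f x ≤ h₁) (h : h₁ ≤ h₂) :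
    M.up (M.up x h₁) h₂ = M.up x h₂ :=
  (M.up_eq_up_of_le (M.le_up x h₁ hx) ((M.f_up x h₁ hx).trans_le h)).symm

end MergeTree

theorem LayerOrder.le_up_of_inducedLeafLe {T : Type*} [PartialOrder T] {M : MergeTree T}
    (L : LayerOrder M) {x y : T} (hxy : inducedLeafLe M L.le x y) {h : ℝ}
    (hx : M.f x ≤ h) (hy : M.f y ≤ h) : L.le h (M.up x h) (M.up y h) := by
  have hm : max (M.f x) (M.f y) ≤ h := max_le hx hy
  have key := L.consistent _ h hm _ _ (M.f_up x _ (le_max_left _ _))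
    (M.f_up y _ (le_max_right _ _)) hxy
  rwa [M.up_up x (le_max_left _ _) hm, M.up_up y (le_max_right _ _) hm] at key

/-- In a merge tree where any two points have a least upper bound
(`⊔` = lca), the induced leaf-order separates subtrees: if `u1 ⊑_L u` and
`u ⊑_L u2` for leaves `u, u1, u2`, then `u ⪯ lca(u1, u2)`. -/
theorem inducedLeafLe_separates_subtrees {T : Type*} [SemilatticeSup T]
    (M : MergeTree T) (L : LayerOrder M)
    (u u1 u2 : T) (hu : IsLeaf u) (hu1 : IsLeaf u1) (hu2 : IsLeaf u2)
    (h1 : inducedLeafLe M L.le u1 u) (h2 : inducedLeafLe M L.le u u2) :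
    u ≤ u1 ⊔ u2 := by
  have up_eq : ∀ h, M.f u ≤ h → M.f (u1 ⊔ u2) ≤ h → M.up u h = M.up (u1 ⊔ u2) h := by
    intro h hfu hfw
    have hf1 := (M.f_le_f (le_sup_left : u1 ≤ u1 ⊔ u2)).trans hfw
    have hf2 := (M.f_le_f (le_sup_right : u2 ≤ u1 ⊔ u2)).trans hfw
    have hl := L.le_up_of_inducedLeafLe h1 hf1 hfu
    have hr := L.le_up_of_inducedLeafLe h2 hfu hf2
    rw [M.up_eq_up_of_le le_sup_left hfw] at hl
    rw [M.up_eq_up_of_le le_sup_right hfw] at hr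
    exact L.antisymm h _ _ (M.f_up _ h hfu) (M.f_up _ h hfw) hr hl
  rcases le_total (M.f u) (M.f (u1 ⊔ u2)) with hle | hle
  · have := M.le_up u _ hle
    rwa [up_eq _ hle le_rfl, M.up_self] at this
  · have := M.le_up (u1 ⊔ u2) _ hle
    rw [← up_eq _ le_rfl hle, M.up_self] at this
    exact (hu _ this).ge
end

section
/- Let (T, ⪯, f) be an order-theoretic merge tree in which any two points have a least upper bound and every point has a leaf below it, equipped with a leaf-order ⊑_L. Then the induced layer-order (≤_h) is consistent: for all h1 ≤ h2 and all x1, x2 ∈ T_{h1}, if x1 ≤_{h1} x2 then x1^{h2} ≤_{h2} x2^{h2}. -/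
/-- A leaf-order on a merge tree whose underlying order has binary least upper
bounds (`⊔` = lca): a total order on the leaves that separates subtrees. -/
structure LeafOrder (T : Type*) [SemilatticeSup T] where
  le : T → T → Prop
  refl : ∀ u : T, IsLeaf u → le u u
  antisymm : ∀ u v : T, IsLeaf u → IsLeaf v → le u v → le v u → u = v
  trans : ∀ u v w : T, IsLeaf u → IsLeaf v → IsLeaf w → le u v → le v w → le u w
  total : ∀ u v : T, IsLeaf u → IsLeaf v → le u v ∨ le v u
  separates : ∀ u u1 u2 : T, IsLeaf u → IsLeaf u1 → IsLeaf u2 →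
    le u1 u → le u u2 → u ≤ u1 ⊔ u2

/-- The layer relation induced by a relation `lle` on leaves:
`x1 ≤ x2` iff `x1 = x2` or every leaf below `x1` is `lle`-below every leaf
below `x2` (i.e. `L(T_{x1}) ⊑_L L(T_{x2})`). -/
def inducedLayerLe {T : Type*} [PartialOrder T] (lle : T → T → Prop)
    (x1 x2 : T) : Prop :=
  x1 = x2 ∨ ∀ u1 : T, IsLeaf u1 → u1 ≤ x1 → ∀ u2 : T, IsLeaf u2 → u2 ≤ x2 → lle u1 u2

/-- Two ancestors of a point that have the same height coincide. -/
theorem MergeTree.eq_of_le_of_le {T : Type*} [PartialOrder T] (M : MergeTree T) {w y z : T}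
    (hy : w ≤ y) (hz : w ≤ z) (h : M.f y = M.f z) : y = z := by
  rcases M.chain hy hz with hyz | hzy
  · exact hyz.eq_of_not_lt fun hlt => (M.strict_mono hlt).ne h
  · exact (hzy.eq_of_not_lt fun hlt => (M.strict_mono hlt).ne h.symm).symm

/-- In a merge tree with binary least upper bounds in which every
point has a leaf below it, the layer-order induced by a leaf-order is
consistent: for `h1 ≤ h2` and `x1, x2` at height `h1`, `x1 ≤_{h1} x2` implies
`x1^{h2} ≤_{h2} x2^{h2}`. -/
theorem inducedLayerLe_consistent {T : Type*} [SemilatticeSup T]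
    (M : MergeTree T) (lo : LeafOrder T)
    (hleaf : ∀ x : T, ∃ u : T, IsLeaf u ∧ u ≤ x)
    (h1 h2 : ℝ) (hh : h1 ≤ h2) (x1 x2 : T)
    (hx1 : M.f x1 = h1) (hx2 : M.f x2 = h1)
    (hxy : inducedLayerLe lo.le x1 x2) :
    inducedLayerLe lo.le (M.up x1 h2) (M.up x2 h2) := by
  have hy1 := M.f_up x1 h2 (hx1.trans_le hh)
  have hy2 := M.f_up x2 h2 (hx2.trans_le hh)
  have hxy1 := M.le_up x1 h2 (hx1.trans_le hh)
  have hxy2 := M.le_up x2 h2 (hx2.trans_le hh)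
  rcases hxy with rfl | hxy
  · exact Or.inl rfl
  by_cases hne : M.up x1 h2 = M.up x2 h2
  · exact Or.inl hne
  have hdisj : ∀ w : T, w ≤ M.up x1 h2 → ¬ w ≤ M.up x2 h2 := fun w hw1 hw2 =>
    hne (M.eq_of_le_of_le hw1 hw2 (hy1.trans hy2.symm))
  obtain ⟨a, ha, hax⟩ := hleaf x1
  obtain ⟨b, hb, hbx⟩ := hleaf x2
  refine Or.inr fun u hu huy v hv hvy => (lo.total u v hu hv).resolve_right fun hvu => ?_
  have hav : lo.le a v := (lo.total a v ha hv).resolve_right fun hva =>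
    hdisj a (hax.trans hxy1) <|
      (lo.separates a v b ha hv hb hva (hxy a ha hax b hb hbx)).trans
        (sup_le hvy (hbx.trans hxy2))
  exact hdisj v ((lo.separates v a u hv ha hu hav hvu).trans
    (sup_le (hax.trans hxy1) huy)) hvy
end
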